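/- arXiv:2011.12129 — 9 statements merged into one kernel-verified Lean document; each statement's English description precedes it below -/
import Mathlib

section
/- Let A be a type and let e, f : A → A satisfy e ∘ e = e and f ∘ f = f. Suppose there exists a natural number n ≥ 1 such that the n-fold composite (e ∘ f)ⁿ equals (f ∘ e)ⁿ, and set h = (e ∘ f)ⁿ. Then h ∘ h = h and the range of h equals the intersection of the range of e and the range of f. -/
/-- if `e, f : A → A` are idempotent and `(e ∘ f)ⁿ = (f ∘ e)ⁿ`
for some `n ≥ 1`, then `h = (e ∘ f)ⁿ` is idempotent and its range is the
intersection of the ranges of `e` and `f`. -/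
theorem stmt10 {A : Type*} (e f : A → A) (he : e ∘ e = e) (hf : f ∘ f = f)
    (n : ℕ) (hn : 1 ≤ n) (hcomm : (e ∘ f)^[n] = (f ∘ e)^[n]) :
    (e ∘ f)^[n] ∘ (e ∘ f)^[n] = (e ∘ f)^[n] ∧
    Set.range (e ∘ f)^[n] = Set.range e ∩ Set.range f := by
  have he' (x : A) : e (e x) = e x := congrFun he x
  have hf' (x : A) : f (f x) = f x := congrFun hf x
  obtain ⟨m, rfl⟩ : ∃ m, n = m + 1 := ⟨n - 1, by omega⟩
  have e_fix (x : A) : e ((e ∘ f)^[m + 1] x) = (e ∘ f)^[m + 1] x := by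
    rw [Function.iterate_succ_apply', Function.comp_apply, he']
  have f_fix (x : A) : f ((e ∘ f)^[m + 1] x) = (e ∘ f)^[m + 1] x := by
    rw [hcomm, Function.iterate_succ_apply', Function.comp_apply, hf']
  have iterate_fix (y : A) (hey : e y = y) (hfy : f y = y) :
      (e ∘ f)^[m + 1] y = y :=
    Function.iterate_fixed (by rw [Function.comp_apply, hfy, hey]) _
  refine ⟨funext fun x => iterate_fix _ (e_fix x) (f_fix x), Set.Subset.antisymm ?_ ?_⟩
  · rintro _ ⟨x, rfl⟩
    exact ⟨⟨_, e_fix x⟩, ⟨_, f_fix x⟩⟩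
  · rintro y ⟨⟨a, rfl⟩, ⟨b, hb⟩⟩
    exact ⟨e a, iterate_fix _ (he' a) (by rw [← hb, hf'])⟩
end

section
/- Let A be a type. Suppose that for any two idempotent functions e, f : A → A (e ∘ e = e and f ∘ f = f) there exists an idempotent function h : A → A whose range equals the intersection of the range of e and the range of f. Then A has at most one element. -/
/-- if for any two idempotent self-maps `e, f` of `A` there is an
idempotent self-map of `A` whose range is the intersection of the ranges of `e`
and `f` (property (RI) for the set `A`), then `A` has at most one element. -/
theorem stmt11 {A : Type*}
    (hRI : ∀ e f : A → A, e ∘ e = e → f ∘ f = f →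
      ∃ h : A → A, h ∘ h = h ∧ Set.range h = Set.range e ∩ Set.range f) :
    Subsingleton A := by
  refine ⟨fun x y => ?_⟩
  obtain ⟨h, -, hr⟩ := hRI (fun _ => x) (fun _ => y) rfl rfl
  have hx : h x ∈ Set.range (fun _ : A => x) ∩ Set.range (fun _ : A => y) :=
    hr ▸ Set.mem_range_self x
  obtain ⟨⟨_, h₁⟩, ⟨_, h₂⟩⟩ := hx
  exact h₁.trans h₂.symm
end

section
/- Let A be a type with a distinguished element a₀. Suppose that any two idempotent maps e, f : A → A fixing a₀ (that is, e ∘ e = e, f ∘ f = f, e(a₀) = a₀ = f(a₀)) with equal ranges are equal. Then A has at most two elements, and moreover any two idempotent maps A → A fixing a₀ commute under composition. -/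
theorem update_id_comp_self {A : Type*} [DecidableEq A] {c x : A} (h : x ≠ c) :
    Function.update id c x ∘ Function.update id c x = Function.update id c x := by
  funext a
  by_cases ha : a = c <;> simp [ha, h]

theorem range_update_id {A : Type*} [DecidableEq A] {c x : A} (h : x ≠ c) :
    Set.range (Function.update id c x) = {c}ᶜ := by
  ext a
  simp only [Set.mem_range, Set.mem_compl_iff, Set.mem_singleton_iff]
  constructor
  · rintro ⟨b, rfl⟩
    by_cases hb : b = c <;> simp [hb, h]
  · intro ha
    exact ⟨a, by simp [ha]⟩

/-- let `(A, a₀)` be a pointed set such that any two idempotent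
endomorphisms of `(A, a₀)` with equal ranges are equal (property (UR)).  Then
`A` has at most two elements, and any two idempotent endomorphisms of
`(A, a₀)` commute under composition. -/
theorem stmt12 {A : Type*} (a₀ : A)
    (hUR : ∀ e f : A → A, e ∘ e = e → f ∘ f = f → e a₀ = a₀ → f a₀ = a₀ →
      Set.range e = Set.range f → e = f) :
    (∃ x y : A, ∀ a : A, a = x ∨ a = y) ∧
    (∀ e f : A → A, e ∘ e = e → f ∘ f = f → e a₀ = a₀ → f a₀ = a₀ →
      e ∘ f = f ∘ e) := by
  classical
  have key : ∀ b c : A, b ≠ a₀ → c = a₀ ∨ c = b := by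
    intro b c hb
    by_contra! hc
    have h := hUR (Function.update id c a₀) (Function.update id c b)
      (update_id_comp_self hc.1.symm) (update_id_comp_self hc.2.symm)
      (by simp [hc.1.symm]) (by simp [hc.1.symm])
      (by rw [range_update_id hc.1.symm, range_update_id hc.2.symm])
    exact hb (by simpa using (congrFun h c).symm)
  refine ⟨?_, fun e f _ _ he₀ hf₀ => ?_⟩
  · by_cases h : ∃ b, b ≠ a₀
    · obtain ⟨b, hb⟩ := h
      exact ⟨a₀, b, fun a => key b a hb⟩
    · push Not at h
      exact ⟨a₀, a₀, fun a => Or.inl (h a)⟩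
  · funext x
    by_cases hx : x = a₀
    · simp [hx, he₀, hf₀]
    · rcases key x (e x) hx with he | he <;> rcases key x (f x) hx with hf | hf <;>
        simp [he, hf, he₀, hf₀]
end

section
/- Let C be an abelian category and A an object of C. Suppose: (i) any two idempotent endomorphisms e, f of A (e composed with itself equals e, and similarly for f) whose image subobjects of A are equal must be equal; and (ii) any two idempotent endomorphisms e, f of A whose kernel subobjects are equal must be equal. Then any two idempotent endomorphisms of A commute. -/
open CategoryTheory CategoryTheory.Limits

theorem CategoryTheory.idempotent_corner_left {C : Type*} [Category C] [Preadditive C] {A : C}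
    {e : A ⟶ A} (he : e ≫ e = e) (f : A ⟶ A) :
    e ≫ (e + f ≫ e - e ≫ f ≫ e) = e ∧
      (e + f ≫ e - e ≫ f ≫ e) ≫ e = e + f ≫ e - e ≫ f ≫ e := by
  constructor
  · simp only [Preadditive.comp_add, Preadditive.comp_sub, he, reassoc_of% he]
    abel
  · simp only [Preadditive.add_comp, Preadditive.sub_comp, Category.assoc, he]

theorem CategoryTheory.idempotent_corner_right {C : Type*} [Category C] [Preadditive C] {A : C}
    {e : A ⟶ A} (he : e ≫ e = e) (f : A ⟶ A) :
    e ≫ (e + e ≫ f - e ≫ f ≫ e) = e + e ≫ f - e ≫ f ≫ e ∧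
      (e + e ≫ f - e ≫ f ≫ e) ≫ e = e := by
  constructor
  · simp only [Preadditive.comp_add, Preadditive.comp_sub, he, reassoc_of% he]
  · simp only [Preadditive.add_comp, Preadditive.sub_comp, Category.assoc, he]
    abel

theorem CategoryTheory.Limits.imageSubobject_eq_of_comp_eq {C : Type*} [Category C] [Abelian C]
    {A : C} {e g : A ⟶ A} (heg : e ≫ g = e) (hge : g ≫ e = g) :
    imageSubobject e = imageSubobject g :=
  le_antisymm (by simpa only [heg] using imageSubobject_comp_le e g)
    (by simpa only [hge] using imageSubobject_comp_le g e)

theorem CategoryTheory.Limits.kernelSubobject_eq_of_comp_eq {C : Type*} [Category C] [Abelian C]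
    {A : C} {e g : A ⟶ A} (heg : e ≫ g = g) (hge : g ≫ e = e) :
    kernelSubobject e = kernelSubobject g :=
  le_antisymm (by simpa only [heg] using kernelSubobject_comp_le e g)
    (by simpa only [hge] using kernelSubobject_comp_le g e)

/-- in an abelian category, if an object `A` satisfies (UR)
(idempotent endomorphisms with equal image subobjects are equal) and (UR*)
(idempotent endomorphisms with equal kernel subobjects are equal), then any two
idempotent endomorphisms of `A` commute. -/
theorem stmt13 {C : Type*} [Category C] [Abelian C] (A : C)
    (hUR : ∀ e f : A ⟶ A, e ≫ e = e → f ≫ f = f →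
      imageSubobject e = imageSubobject f → e = f)
    (hURstar : ∀ e f : A ⟶ A, e ≫ e = e → f ≫ f = f →
      kernelSubobject e = kernelSubobject f → e = f)
    (e f : A ⟶ A) (he : e ≫ e = e) (hf : f ≫ f = f) :
    e ≫ f = f ≫ e := by
  have hleft : f ≫ e = e ≫ f ≫ e := by
    obtain ⟨heg, hge⟩ := idempotent_corner_left he f
    have hg := hUR e _ he (by rw [← hge, Category.assoc, reassoc_of% heg, he])
      (imageSubobject_eq_of_comp_eq heg hge)
    rwa [add_sub_assoc, left_eq_add, sub_eq_zero] at hg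
  have hright : e ≫ f = e ≫ f ≫ e := by
    obtain ⟨heg, hge⟩ := idempotent_corner_right he f
    have hg := hURstar e _ he (by rw [← heg, Category.assoc, reassoc_of% hge, heg, heg])
      (kernelSubobject_eq_of_comp_eq heg hge)
    rwa [add_sub_assoc, left_eq_add, sub_eq_zero] at hg
  exact hright.trans hleft.symm
end

section
/- Let G be a commutative group acting on a type A. Suppose: (i) any two idempotent G-equivariant maps e, f : A → A with equal ranges are equal; and (ii) for any two idempotent G-equivariant maps e, f : A → A there exists an idempotent G-equivariant map h : A → A whose range equals the intersection of the range of e and the range of f. Then any two idempotent G-equivariant maps A → A commute under composition. -/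
open Classical in
/-- Translating an equivariant retraction by `g` off its range, for commutative `G`, gives another
equivariant retraction with the same range. -/
theorem twist_retraction {G A : Type*} [CommGroup G] [MulAction G A] {e : A → A}
    (he : ∀ (g : G) (a : A), e (g • a) = g • e a) (idem : ∀ x, e (e x) = e x) (g : G) :
    let e' : A → A := fun x => if e x = x then x else g • e x
    (∀ (k : G) (a : A), e' (k • a) = k • e' a) ∧ e' ∘ e' = e' ∧ Set.range e = Set.range e' := by
  intro e'
  have e'_of_eq {x : A} (hx : e x = x) : e' x = x := if_pos hx
  have map_e' (x : A) : e (e' x) = e' x := by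
    by_cases hx : e x = x
    · rw [e'_of_eq hx, hx]
    · simp [e', hx, he, idem]
  refine ⟨fun k a => ?_, funext fun x => e'_of_eq (map_e' x), ?_⟩
  · by_cases ha : e a = a
    · simp [e', he, ha]
    · simp [e', he, ha, smul_comm g k]
  · ext y
    constructor
    · rintro ⟨x, rfl⟩
      exact ⟨e x, e'_of_eq (idem x)⟩
    · rintro ⟨x, rfl⟩
      exact ⟨e' x, map_e' x⟩

/-- let `G` be a commutative group acting on a type `A`.  If
(UR) any two idempotent `G`-equivariant self-maps of `A` with equal ranges are
equal, and (RI) for any two idempotent `G`-equivariant self-maps `e, f` there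
is an idempotent `G`-equivariant self-map whose range is `range e ∩ range f`,
then any two idempotent `G`-equivariant self-maps of `A` commute. -/
theorem stmt14 {G : Type*} [CommGroup G] {A : Type*} [MulAction G A]
    (hUR : ∀ e f : A → A,
      (∀ (g : G) (a : A), e (g • a) = g • e a) →
      (∀ (g : G) (a : A), f (g • a) = g • f a) →
      e ∘ e = e → f ∘ f = f → Set.range e = Set.range f → e = f)
    (hRI : ∀ e f : A → A,
      (∀ (g : G) (a : A), e (g • a) = g • e a) →
      (∀ (g : G) (a : A), f (g • a) = g • f a) →
      e ∘ e = e → f ∘ f = f →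
      ∃ h : A → A, (∀ (g : G) (a : A), h (g • a) = g • h a) ∧ h ∘ h = h ∧
        Set.range h = Set.range e ∩ Set.range f)
    (e f : A → A)
    (he : ∀ (g : G) (a : A), e (g • a) = g • e a)
    (hf : ∀ (g : G) (a : A), f (g • a) = g • f a)
    (hee : e ∘ e = e) (hff : f ∘ f = f) :
    e ∘ f = f ∘ e := by
  have fixed_of_map {e : A → A} (he : ∀ (g : G) (a : A), e (g • a) = g • e a) {a : A}
      (ha : ∀ g : G, g • a = a) (g : G) : g • e a = e a := by
    rw [← he, ha]
  have fixed_unique {y z : A} (hy : ∀ g : G, g • y = y) (hz : ∀ g : G, g • z = z) : y = z := by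
    obtain ⟨h, -, -, hr⟩ := hRI (fun _ => y) (fun _ => z) (fun g _ => (hy g).symm)
      (fun g _ => (hz g).symm) rfl rfl
    have hmem : h y ∈ Set.range (fun _ : A => y) ∩ Set.range (fun _ : A => z) :=
      hr ▸ Set.mem_range_self y
    obtain ⟨⟨_, h₁⟩, ⟨_, h₂⟩⟩ := hmem
    exact h₁.trans h₂.symm
  have eq_or_fixed {e : A → A} (he : ∀ (g : G) (a : A), e (g • a) = g • e a)
      (hee : e ∘ e = e) (a : A) : e a = a ∨ ∀ g : G, g • e a = e a := by
    refine or_iff_not_imp_left.mpr fun ha g => ?_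
    have idem (x : A) : e (e x) = e x := congrFun hee x
    have key := twist_retraction he idem g
    have h := hUR e _ he key.1 hee key.2.1 key.2.2
    simpa [ha] using (congrFun h a).symm
  funext a
  change e (f a) = f (e a)
  rcases eq_or_fixed he hee a with h₁ | h₁ <;> rcases eq_or_fixed hf hff a with h₂ | h₂
  · rw [h₁, h₂, h₁]
  · rw [h₁]
    exact fixed_unique (fixed_of_map he h₂) h₂
  · rw [h₂]
    exact fixed_unique h₁ (fixed_of_map hf h₁)
  · exact fixed_unique (fixed_of_map he h₂) (fixed_of_map hf h₁)
end

section
/- In the presented monoid T, the idempotent elements are exactly the images of the empty word 1 and of the generators e, f, g (that is, an element t ∈ T satisfies t·t = t if and only if t ∈ {1, e, f, g}). -/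
/-- The three generators `e, f, g`. -/
inductive Gen : Type
  | e | f | g
  deriving DecidableEq

open FreeMonoid in
/-- The relations `e·e = e`, `f·f = f`, `g·g = g`, `e·g = g·e = g`,
`f·g = g·f = g` on the free monoid on the generators. -/
inductive rels : FreeMonoid Gen → FreeMonoid Gen → Prop
  | ee : rels (of Gen.e * of Gen.e) (of Gen.e)
  | ff : rels (of Gen.f * of Gen.f) (of Gen.f)
  | gg : rels (of Gen.g * of Gen.g) (of Gen.g)
  | eg : rels (of Gen.e * of Gen.g) (of Gen.g)
  | ge : rels (of Gen.g * of Gen.e) (of Gen.g)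
  | fg : rels (of Gen.f * of Gen.g) (of Gen.g)
  | gf : rels (of Gen.g * of Gen.f) (of Gen.g)

/-- The monoid `T` presented by generators `e, f, g` and the relations above:
the quotient of the free monoid on `{e, f, g}` by the smallest congruence
containing the relations. -/
abbrev T : Type := PresentedMonoid rels

/-- The image of the generator `e` in `T`. -/
def tE : T := PresentedMonoid.of rels Gen.e

/-- The image of the generator `f` in `T`. -/
def tF : T := PresentedMonoid.of rels Gen.f

/-- The image of the generator `g` in `T`. -/
def tG : T := PresentedMonoid.of rels Gen.g

namespace T

theorem tE_mul_tE : tE * tE = tE := Quotient.sound (ConGen.Rel.of _ _ .ee)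

theorem tF_mul_tF : tF * tF = tF := Quotient.sound (ConGen.Rel.of _ _ .ff)

theorem tG_mul_tG : tG * tG = tG := Quotient.sound (ConGen.Rel.of _ _ .gg)

theorem tE_mul_tG : tE * tG = tG := Quotient.sound (ConGen.Rel.of _ _ .eg)

theorem tG_mul_tE : tG * tE = tG := Quotient.sound (ConGen.Rel.of _ _ .ge)

theorem tF_mul_tG : tF * tG = tG := Quotient.sound (ConGen.Rel.of _ _ .fg)

theorem tG_mul_tF : tG * tF = tG := Quotient.sound (ConGen.Rel.of _ _ .gf)

theorem induction_mul_left {p : T → Prop} (one : p 1) (e : ∀ t, p t → p (tE * t))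
    (f : ∀ t, p t → p (tF * t)) (g : ∀ t, p t → p (tG * t)) (t : T) : p t := by
  induction t using PresentedMonoid.inductionOn with
  | h w =>
    induction w using FreeMonoid.inductionOn' with
    | one => exact one
    | of_mul x w ih =>
      rw [map_mul]
      cases x
      exacts [e _ ih, f _ ih, g _ ih]

/-- `g` is a left zero of `T`. -/
theorem tG_mul (t : T) : tG * t = tG := by
  induction t using induction_mul_left with
  | one => exact mul_one _
  | e t ih => rw [← mul_assoc, tG_mul_tE, ih]
  | f t ih => rw [← mul_assoc, tG_mul_tF, ih]
  | g t ih => rw [← mul_assoc, tG_mul_tG, ih]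

/-- Every element of `T` is `1`, `g` or a nonempty alternating word in `e` and `f`. -/
theorem eq_one_or_eq_tG_or_alternating (t : T) :
    t = 1 ∨ t = tG ∨ ∃ k : ℕ, t = (tE * tF) ^ k * tE ∨ t = tF * (tE * tF) ^ k ∨
      t = (tE * tF) ^ (k + 1) ∨ t = tF * (tE * tF) ^ k * tE := by
  have he (k : ℕ) : tE * (tE * tF) ^ (k + 1) = (tE * tF) ^ (k + 1) := by
    rw [pow_succ', ← mul_assoc, ← mul_assoc, tE_mul_tE]
  induction t using induction_mul_left with
  | one => exact .inl rfl
  | e t ih =>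
    obtain rfl | rfl | ⟨k, rfl | rfl | rfl | rfl⟩ := ih
    · exact .inr (.inr ⟨0, .inl (by simp)⟩)
    · exact .inr (.inl tE_mul_tG)
    · refine .inr (.inr ⟨k, .inl ?_⟩)
      cases k with
      | zero => simp [tE_mul_tE]
      | succ k => rw [← mul_assoc, he]
    · exact .inr (.inr ⟨k, .inr (.inr (.inl (by rw [pow_succ', mul_assoc])))⟩)
    · exact .inr (.inr ⟨k, .inr (.inr (.inl (he k)))⟩)
    · exact .inr (.inr ⟨k + 1, .inl (by simp only [pow_succ', mul_assoc])⟩)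
  | f t ih =>
    obtain rfl | rfl | ⟨k, rfl | rfl | rfl | rfl⟩ := ih
    · exact .inr (.inr ⟨0, .inr (.inl (by simp))⟩)
    · exact .inr (.inl tF_mul_tG)
    · exact .inr (.inr ⟨k, .inr (.inr (.inr (mul_assoc _ _ _).symm))⟩)
    · exact .inr (.inr ⟨k, .inr (.inl (by rw [← mul_assoc, tF_mul_tF]))⟩)
    · exact .inr (.inr ⟨k + 1, .inr (.inl rfl)⟩)
    · exact .inr (.inr ⟨k, .inr (.inr (.inr (by rw [← mul_assoc, ← mul_assoc, tF_mul_tF])))⟩)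
  | g t => exact .inr (.inl (tG_mul t))

/-- Values on the generators of a representation of `T` by `2 × 2` matrices. -/
def genMatrix : Gen → Matrix (Fin 2) (Fin 2) ℕ
  | .e => !![1, 1; 0, 0]
  | .f => !![1, 0; 1, 0]
  | .g => 0

/-- A representation of `T` by `2 × 2` matrices in which `e * f` acts as `diag(2, 0)`. -/
def toMatrix : T →* Matrix (Fin 2) (Fin 2) ℕ :=
  PresentedMonoid.lift genMatrix (by rintro _ _ ⟨⟩ <;> decide)

theorem toMatrix_tE : toMatrix tE = !![1, 1; 0, 0] := rfl

theorem toMatrix_tF : toMatrix tF = !![1, 0; 1, 0] := rfl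

theorem toMatrix_tE_mul_tF_pow (k : ℕ) :
    toMatrix ((tE * tF) ^ k) = !![2 ^ k, 0; 0, 0 ^ k] := by
  induction k with
  | zero => simp [Matrix.one_fin_two]
  | succ k ih =>
    rw [pow_succ, map_mul, map_mul, ih, toMatrix_tE, toMatrix_tF]
    ext i j
    fin_cases i <;> fin_cases j <;> simp [pow_succ]

end T

open T in
/-- in the presented monoid `T`, the idempotent elements are
exactly the images of the empty word `1` and of the generators `e, f, g`. -/
theorem stmt16 (t : T) : t * t = t ↔ (t = 1 ∨ t = tE ∨ t = tF ∨ t = tG) := by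
  constructor
  · intro h
    have h00 := congr_fun₂ (congr_arg toMatrix h) 0 0
    obtain rfl | rfl | ⟨k, rfl | rfl | rfl | rfl⟩ := eq_one_or_eq_tG_or_alternating t
    · exact .inl rfl
    · exact .inr (.inr (.inr rfl))
    · rw [map_mul, map_mul, toMatrix_tE_mul_tF_pow, toMatrix_tE] at h00
      obtain rfl : k = 0 := by simpa using h00
      simp
    · rw [map_mul, map_mul, toMatrix_tE_mul_tF_pow, toMatrix_tF] at h00
      obtain rfl : k = 0 := by simpa using h00
      simp
    · rw [map_mul, toMatrix_tE_mul_tF_pow] at h00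
      simp at h00
    · rw [map_mul, map_mul, map_mul, toMatrix_tE_mul_tF_pow, toMatrix_tE, toMatrix_tF] at h00
      have := Nat.two_pow_pos k
      simp at h00
      nlinarith
  · rintro (rfl | rfl | rfl | rfl)
    exacts [mul_one 1, tE_mul_tE, tF_mul_tF, tG_mul_tG]
end

section
/- In the presented monoid T, the element g is absorbing (g·t = t·g = g for all t ∈ T), the principal right ideal gT equals the singleton {g}, and the intersection of the principal right ideals eT and fT equals gT = {g}. -/
/-- Left multiplication by a generator, acting on the first letter of a normal form
(`none` for the empty word). -/
def leadingAct (a : Gen) : Function.End (Option Gen) :=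
  fun s => if s = some Gen.g then some Gen.g else some a

/-- The action of `T` on leading letters. -/
def leadingHom : T →* Function.End (Option Gen) :=
  PresentedMonoid.lift leadingAct (by
    rintro _ _ (_ | _) <;> funext s <;> rcases s with _ | _ | _ | _ <;> rfl)

theorem leadingHom_of_mul (a : Gen) (t : T) :
    leadingHom (PresentedMonoid.of rels a * t) none = leadingAct a (leadingHom t none) := by
  rw [map_mul, show leadingHom (PresentedMonoid.of rels a) = leadingAct a from
    PresentedMonoid.lift_of _ _]
  rfl

theorem of_mul_of_eq {a b c : Gen}
    (h : rels (FreeMonoid.of a * FreeMonoid.of b) (FreeMonoid.of c)) :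
    PresentedMonoid.of rels a * PresentedMonoid.of rels b = PresentedMonoid.of rels c :=
  PresentedMonoid.mk_eq_mk_of_rel h

/-- Induction on elements of `T` by left multiplication by generators. -/
theorem T_induction {p : T → Prop} (one : p 1)
    (of_mul : ∀ a t, p t → p (PresentedMonoid.of rels a * t)) (t : T) : p t := by
  induction t using PresentedMonoid.inductionOn with
  | _ w =>
    induction w using FreeMonoid.inductionOn' with
    | one => exact one
    | of_mul a w ih => exact of_mul a _ ih

theorem of_mul_tG (a : Gen) : PresentedMonoid.of rels a * tG = tG := by
  cases a
  exacts [of_mul_of_eq .eg, of_mul_of_eq .fg, of_mul_of_eq .gg]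

theorem tG_mul_of (a : Gen) : tG * PresentedMonoid.of rels a = tG := by
  cases a
  exacts [of_mul_of_eq .ge, of_mul_of_eq .gf, of_mul_of_eq .gg]

theorem tG_mul (t : T) : tG * t = tG := by
  induction t using T_induction with
  | one => exact mul_one _
  | of_mul a t ih => rw [← mul_assoc, tG_mul_of, ih]

theorem mul_tG (t : T) : t * tG = tG := by
  induction t using T_induction with
  | one => exact one_mul _
  | of_mul a t ih => rw [mul_assoc, ih, of_mul_tG]

theorem eq_tG_of_leadingHom {t : T} (h : leadingHom t none = some Gen.g) : t = tG := by
  induction t using T_induction with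
  | one => rw [map_one] at h; cases h
  | of_mul a t ih =>
    rw [leadingHom_of_mul] at h
    by_cases ht : leadingHom t none = some Gen.g
    · rw [ih ht, of_mul_tG]
    · obtain rfl : a = Gen.g := by simpa [leadingAct, ht] using h
      exact tG_mul t

/-- in `T`, the element `g` is absorbing, the principal right
ideal `gT` is the singleton `{g}`, and `eT ∩ fT = gT = {g}`. -/
theorem stmt17 :
    (∀ t : T, tG * t = tG ∧ t * tG = tG) ∧
    {x : T | ∃ t : T, x = tG * t} = {tG} ∧
    {x : T | ∃ t : T, x = tE * t} ∩ {x : T | ∃ t : T, x = tF * t} =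
      {x : T | ∃ t : T, x = tG * t} := by
  refine ⟨fun t => ⟨tG_mul t, mul_tG t⟩, ?_, ?_⟩
  · ext x
    simp [tG_mul]
  · ext x
    constructor
    · rintro ⟨⟨t, ht⟩, ⟨u, hu⟩⟩
      refine ⟨1, (eq_tG_of_leadingHom ?_).trans (mul_one tG).symm⟩
      have he := leadingHom_of_mul Gen.e t
      have hf := leadingHom_of_mul Gen.f u
      change leadingHom (tE * t) none = _ at he
      change leadingHom (tF * u) none = _ at hf
      rw [← ht] at he
      rw [← hu] at hf
      unfold leadingAct at he hf
      split_ifs at he hf <;> simp_all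
    · rintro ⟨t, rfl⟩
      rw [tG_mul]
      exact ⟨⟨tG, (mul_tG tE).symm⟩, ⟨tG, (mul_tG tF).symm⟩⟩
end

section
/- The presented monoid T is infinite; more precisely, the alternating products e, f, e·f, f·e, e·f·e, f·e·f, ... (images in T of the nonempty words in e and f in which e and f alternate) are pairwise distinct elements of T. -/
/-- `alt n b` is the image in `T` of the alternating word in `e` and `f` of
length `n + 1` starting with `e` (if `b = true`) or with `f` (if `b = false`):
`alt 0 true = e`, `alt 1 true = e·f`, `alt 2 true = e·f·e`, and so on. -/
def alt : ℕ → Bool → T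
  | 0, true => tE
  | 0, false => tF
  | n + 1, true => tE * alt n false
  | n + 1, false => tF * alt n true

/-- Prefixing the letter `b` to an alternating word with first letter `p.2` and `p.1` changes of
letter, where a repeated first letter is absorbed. -/
def prefixLetter (b : Bool) (p : ℕ × Bool) : ℕ × Bool :=
  if p.2 = b then p else (p.1 + 1, b)

/-- The action of the generators on alternating words with an added zero `none`: `e` and `f` prefix
a letter, and `g` sends everything to zero. -/
def genAction : Gen → Function.End (Option (ℕ × Bool))
  | Gen.e => Option.map (prefixLetter true)
  | Gen.f => Option.map (prefixLetter false)
  | Gen.g => fun _ => none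

theorem lift_genAction_eq_of_rels (a b : FreeMonoid Gen) (h : rels a b) :
    FreeMonoid.lift genAction a = FreeMonoid.lift genAction b := by
  cases h <;> simp only [map_mul, FreeMonoid.lift_eval_of] <;> funext p <;>
    rcases p with _ | ⟨n, _ | _⟩ <;> rfl

/-- The action of `T` on alternating words with an added zero. -/
def wordAction : T →* Function.End (Option (ℕ × Bool)) :=
  PresentedMonoid.lift genAction lift_genAction_eq_of_rels

theorem wordAction_tE : wordAction tE = Option.map (prefixLetter true) := rfl

theorem wordAction_tF : wordAction tF = Option.map (prefixLetter false) := rfl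

theorem exists_wordAction_alt (n : ℕ) (b : Bool) :
    ∃ x : Bool, wordAction (alt n b) (some (0, x)) = some (n, b) ∧
      wordAction (alt n b) (some (0, !x)) = some (n + 1, b) := by
  induction n generalizing b with
  | zero => cases b <;> [exact ⟨false, rfl, rfl⟩; exact ⟨true, rfl, rfl⟩]
  | succ n ih =>
    obtain ⟨x, h₁, h₂⟩ := ih (!b)
    refine ⟨x, ?_⟩
    cases b
    · rw [alt, map_mul, wordAction_tF]
      exact ⟨congrArg (Option.map (prefixLetter false)) h₁,
        congrArg (Option.map (prefixLetter false)) h₂⟩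
    · rw [alt, map_mul, wordAction_tE]
      exact ⟨congrArg (Option.map (prefixLetter true)) h₁,
        congrArg (Option.map (prefixLetter true)) h₂⟩

theorem alt_injective : Function.Injective (fun p : ℕ × Bool => alt p.1 p.2) := by
  rintro ⟨n, b⟩ ⟨m, c⟩ (h : alt n b = alt m c)
  obtain ⟨x, hx₁, hx₂⟩ := exists_wordAction_alt n b
  obtain ⟨y, hy₁, hy₂⟩ := exists_wordAction_alt m c
  rw [h] at hx₁ hx₂
  obtain rfl | rfl := Bool.eq_or_eq_not x y
  · exact Option.some.inj (hx₁.symm.trans hy₁)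
  · rw [Bool.not_not] at hx₂
    have h₁ := congrArg Prod.fst (Option.some.inj (hx₁.symm.trans hy₂))
    have h₂ := congrArg Prod.fst (Option.some.inj (hx₂.symm.trans hy₁))
    dsimp only at h₁ h₂
    omega

/-- the presented monoid `T` is infinite; more precisely, the
alternating products `e, f, e·f, f·e, e·f·e, f·e·f, …` are pairwise distinct
elements of `T`. -/
theorem stmt18 :
    Function.Injective (fun p : ℕ × Bool => alt p.1 p.2) ∧ Infinite T :=
  ⟨alt_injective, Infinite.of_injective _ alt_injective⟩
end

section
/- There exists a monoid S containing idempotent elements e, f with e·f ≠ f·e, such that: (UR) any two idempotents of S generating the same principal right ideal are equal; (RI) for any two idempotents u, v of S there is an idempotent w with uS ∩ vS = wS; (UR*) any two idempotents u, v of S satisfying (for all x, y ∈ S) u·x = u·y if and only if v·x = v·y are equal; and (RI*) for any two idempotents u, v of S, the equivalence relation on S generated by {(x,y) : u·x = u·y or v·x = v·y} equals {(x,y) : w·x = w·y} for some idempotent w ∈ S. -/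
universe u

/-- The elements of the monoid with zero `⟨e, f | e² = e, f² = f, ef = 0⟩`, where `n = fe`. -/
inductive FiveMonoid : Type u
  | one | e | f | n | zero
  deriving DecidableEq

namespace FiveMonoid

instance : Fintype FiveMonoid.{u} where
  elems := {one, e, f, n, zero}
  complete x := by cases x <;> simp

/-- Multiplication in the five-element monoid. -/
def mul : FiveMonoid.{u} → FiveMonoid.{u} → FiveMonoid.{u}
  | one, x => x
  | x, one => x
  | e, e => e
  | f, f => f
  | f, e => n
  | f, n => n
  | n, e => n
  | _, _ => zero

instance : Monoid FiveMonoid.{u} where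
  mul := mul
  one := one
  mul_assoc := by decide
  one_mul := by decide
  mul_one := by decide

theorem e_mul_f_ne : (e : FiveMonoid.{u}) * f ≠ f * e := by decide

theorem eq_of_mem_principal : ∀ u v : FiveMonoid.{u}, u * u = u → v * v = v →
    (∃ s, u = v * s) → (∃ s, v = u * s) → u = v := by decide

theorem exists_inter_principal : ∀ u v : FiveMonoid.{u}, u * u = u → v * v = v →
    ∃ w : FiveMonoid.{u}, w * w = w ∧
      ∀ x, ((∃ s, x = u * s) ∧ (∃ s, x = v * s)) ↔ ∃ s, x = w * s := by decide

theorem eq_of_ker_eq : ∀ u v : FiveMonoid.{u}, u * u = u → v * v = v →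
    (∀ x y, u * x = u * y ↔ v * x = v * y) → u = v := by decide

theorem exists_ker_chain : ∀ u v : FiveMonoid.{u}, u * u = u → v * v = v →
    ∃ w : FiveMonoid.{u}, w * w = w ∧ (∀ x y, u * x = u * y ∨ v * x = v * y → w * x = w * y) ∧
      ∃ a b : FiveMonoid.{u}, (u * 1 = u * a ∨ v * 1 = v * a) ∧ (u * a = u * b ∨ v * a = v * b) ∧
        (u * b = u * w ∨ v * b = v * w) := by decide

end FiveMonoid

/-- If `1` and `w` are related by the join of the kernels of `u` and `v`, and `w` is constant
on those kernels, then the join is the kernel of `w`. -/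
theorem eqvGen_ker_iff {M : Type*} [Monoid M] {u v w : M}
    (h : ∀ x y, u * x = u * y ∨ v * x = v * y → w * x = w * y)
    (hw : Relation.EqvGen (fun x y : M => u * x = u * y ∨ v * x = v * y) 1 w) (x y : M) :
    Relation.EqvGen (fun x y : M => u * x = u * y ∨ v * x = v * y) x y ↔ w * x = w * y := by
  have right_compat : ∀ {a b : M},
      Relation.EqvGen (fun x y : M => u * x = u * y ∨ v * x = v * y) a b → ∀ z,
      Relation.EqvGen (fun x y : M => u * x = u * y ∨ v * x = v * y) (a * z) (b * z) := by
    intro a b hab z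
    induction hab with
    | rel a b hab =>
      refine .rel _ _ (hab.imp (fun k => ?_) (fun k => ?_)) <;>
        rw [← mul_assoc, k, mul_assoc]
    | refl a => exact .refl _
    | symm a b _ ih => exact ih.symm
    | trans a b c _ _ ih₁ ih₂ => exact ih₁.trans _ _ _ ih₂
  constructor
  · intro hxy
    induction hxy with
    | rel a b hab => exact h a b hab
    | refl a => rfl
    | symm a b _ ih => exact ih.symm
    | trans a b c _ _ ih₁ ih₂ => exact ih₁.trans ih₂
  · intro hxy
    have hx := right_compat hw x
    have hy := right_compat hw y
    rw [one_mul] at hx hy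
    rw [← hxy] at hy
    exact hx.trans _ _ _ hy.symm

/-- there exists a monoid `S` with non-commuting idempotents
`e, f` which nevertheless satisfies the four properties (UR), (RI), (UR*),
(RI*), phrased for `S` viewed as a right `S`-set under its own multiplication:
(UR) idempotents generating the same principal right ideal are equal;
(RI) the intersection of the principal right ideals of two idempotents is the
principal right ideal of an idempotent;
(UR*) idempotents whose left-multiplication maps have equal kernel relations
are equal;
(RI*) for any two idempotents `u, v`, the equivalence relation generated by
`{(x,y) : u·x = u·y or v·x = v·y}` is the kernel relation of an idempotent. -/
theorem stmt19 :
    ∃ (S : MonCat) (e f : S),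
      e * e = e ∧ f * f = f ∧ e * f ≠ f * e ∧
      (∀ u v : S, u * u = u → v * v = v →
        {x : S | ∃ s : S, x = u * s} = {x : S | ∃ s : S, x = v * s} → u = v) ∧
      (∀ u v : S, u * u = u → v * v = v →
        ∃ w : S, w * w = w ∧
          {x : S | ∃ s : S, x = u * s} ∩ {x : S | ∃ s : S, x = v * s} =
            {x : S | ∃ s : S, x = w * s}) ∧
      (∀ u v : S, u * u = u → v * v = v →
        (∀ x y : S, u * x = u * y ↔ v * x = v * y) → u = v) ∧
      (∀ u v : S, u * u = u → v * v = v →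
        ∃ w : S, w * w = w ∧
          ∀ x y : S,
            Relation.EqvGen (fun x y : S => u * x = u * y ∨ v * x = v * y) x y ↔
              w * x = w * y) := by
  refine ⟨MonCat.of FiveMonoid, FiveMonoid.e, FiveMonoid.f, rfl, rfl,
    FiveMonoid.e_mul_f_ne, ?_, ?_, FiveMonoid.eq_of_ker_eq, ?_⟩
  · intro u v hu hv h
    refine FiveMonoid.eq_of_mem_principal u v hu hv ?_ ?_
    · exact h.subset ⟨u, hu.symm⟩
    · exact h.superset ⟨v, hv.symm⟩
  · intro u v hu hv
    obtain ⟨w, hw, h⟩ := FiveMonoid.exists_inter_principal u v hu hv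
    exact ⟨w, hw, Set.ext h⟩
  · intro u v hu hv
    obtain ⟨w, hw, h, a, b, h₁, h₂, h₃⟩ := FiveMonoid.exists_ker_chain u v hu hv
    exact ⟨w, hw, eqvGen_ker_iff h
      (.trans _ _ _ (.rel _ _ h₁) (.trans _ _ _ (.rel _ _ h₂) (.rel _ _ h₃)))⟩
end
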